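/- For Q(z) = |z|² and a fixed z₀ ≠ 0, a positive integer d, and any integer n ≥ d+1, the principal-value integral of z^{−j} (0 ≤ j ≤ d) against the Berezin measure dB^{z₀}_{m,n}(z) = m |E_{n−1}(m z z̄₀)|² / E_{n−1}(m|z₀|²) · e^{−m|z|²} dA(z) equals z₀^{−j} ( 1 − E_{j−1}(m|z₀|²)/E_{n−1}(m|z₀|²) ). In particular, p.v. ∫_ℂ u(z^{−1}) dB^{z₀}_{m,n}(z) → u(z₀^{−1}) as m → ∞, uniformly in n ≥ d+1, for every analytic polynomial u of degree at most d. -/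

import Mathlib

open MeasureTheory Metric Complex Filter

noncomputable def dA : Measure ℂ := (ENNReal.ofReal Real.pi)⁻¹ • volume

/-- truncated exponential (complex), with `E_k = 0` for `k < 0` -/
noncomputable def EC (k : ℤ) (z : ℂ) : ℂ :=
  ∑ j ∈ Finset.range (k + 1).toNat, z ^ j / (Nat.factorial j)

/-- truncated exponential (real), with `E_k = 0` for `k < 0` -/
noncomputable def ER (k : ℤ) (x : ℝ) : ℝ :=
  ∑ j ∈ Finset.range (k + 1).toNat, x ^ j / (Nat.factorial j)

/-- the Berezin density for the Bargmann–Fock weight `Q(z)=|z|²` -/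
noncomputable def berBF (m : ℝ) (n : ℕ) (z₀ z : ℂ) : ℝ :=
  m * ‖EC ((n : ℤ) - 1) ((m : ℂ) * z * (starRingEnd ℂ) z₀)‖ ^ 2 /
    ER ((n : ℤ) - 1) (m * ‖z₀‖ ^ 2) * Real.exp (-(m * ‖z‖ ^ 2))

/-- the principal value `p.v.∫ f dμ = lim_{ε→0⁺} ∫_{|z|≥ε} f dμ` equals `L` -/
def PVIntegralEq (f : ℂ → ℂ) (μ : Measure ℂ) (L : ℂ) : Prop :=
  Tendsto (fun ε : ℝ => ∫ z in {w : ℂ | ε ≤ ‖w‖}, f z ∂μ) (nhdsWithin 0 (Set.Ioi 0)) (nhds L)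

theorem integrable_norm_pow_mul_exp {m : ℝ} (hm : 0 < m) (p : ℕ) :
    Integrable fun z : ℂ => ‖z‖ ^ p * Real.exp (-(m * ‖z‖ ^ 2)) := by
  have h := Complex.integral_rpow_mul_exp_neg_mul_rpow (p := 2) (q := p) (b := m) (by norm_num)
    (by have : (0 : ℝ) ≤ p := p.cast_nonneg
        linarith) hm
  have hne : ∫ z : ℂ, ‖z‖ ^ (p : ℝ) * Real.exp (-m * ‖z‖ ^ (2 : ℝ)) ≠ 0 := by
    rw [h]
    have : 0 < Real.Gamma (((p : ℝ) + 2) / 2) := Real.Gamma_pos_of_pos (by positivity)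
    positivity
  simpa using Integrable.of_integral_ne_zero hne

theorem integral_norm_pow_mul_exp {m : ℝ} (hm : 0 < m) (k : ℕ) :
    ∫ z : ℂ, ‖z‖ ^ (2 * k) * Real.exp (-(m * ‖z‖ ^ 2)) ∂dA = k.factorial / m ^ (k + 1) := by
  have h := Complex.integral_rpow_mul_exp_neg_mul_rpow (p := 2) (q := (2 * k : ℕ)) (b := m)
    (by norm_num)
    (by have : (0 : ℝ) ≤ (2 * k : ℕ) := Nat.cast_nonneg _
        linarith) hm
  have e : (((2 * k : ℕ) : ℝ) + 2) / 2 = (k : ℝ) + 1 := by push_cast; ring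
  have e' : -(((2 * k : ℕ) : ℝ) + 2) / 2 = -((k + 1 : ℕ) : ℝ) := by push_cast; ring
  rw [e', e, Real.Gamma_nat_eq_factorial, Real.rpow_neg hm.le, Real.rpow_natCast] at h
  simp only [Real.rpow_natCast, Real.rpow_ofNat, neg_mul] at h
  rw [dA, integral_smul_measure, h, ENNReal.toReal_inv, ENNReal.toReal_ofReal Real.pi_pos.le]
  have := Real.pi_pos
  simp only [smul_eq_mul]
  field_simp

theorem inv_ofReal_pi_ne_top : (ENNReal.ofReal Real.pi)⁻¹ ≠ ⊤ := by
  simp [Real.pi_pos]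

theorem dA_absolutelyContinuous : dA ≪ volume :=
  Measure.smul_absolutelyContinuous

theorem measurePreserving_rotation_dA (a : Circle) :
    MeasurePreserving (rotation a) dA dA :=
  (rotation a).measurePreserving.smul_measure _

theorem setIntegral_rotation (a : Circle) (f : ℂ → ℂ) (ε : ℝ) :
    ∫ z in {w : ℂ | ε ≤ ‖w‖}, f (a * z) ∂dA = ∫ z in {w : ℂ | ε ≤ ‖w‖}, f z ∂dA := by
  have h := (measurePreserving_rotation_dA a).setIntegral_preimage_emb
    (rotation a).toHomeomorph.measurableEmbedding f {w : ℂ | ε ≤ ‖w‖}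
  simp only [Set.preimage_ofPred_eq, LinearIsometryEquiv.norm_map] at h
  simpa only [rotation_apply] using h

/-- The monomial `z ^ (-j) * z ^ l * conj z ^ k` with a Gaussian weight. -/
noncomputable def gaussMonomial (m : ℝ) (j l k : ℕ) (z : ℂ) : ℂ :=
  z ^ (-(j : ℤ)) * z ^ l * (starRingEnd ℂ) z ^ k * (Real.exp (-(m * ‖z‖ ^ 2)) : ℂ)

theorem gaussMonomial_rotation (m : ℝ) (j l k : ℕ) (a : Circle) (z : ℂ) :
    gaussMonomial m j l k (a * z) =
      (a : ℂ) ^ ((l : ℤ) - j - k) * gaussMonomial m j l k z := by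
  have ha : (a : ℂ) ≠ 0 := a.coe_ne_zero
  simp only [gaussMonomial, mul_pow, map_mul, ← Circle.coe_inv_eq_conj, norm_mul,
    Circle.norm_coe, one_mul, sub_eq_add_neg, zpow_add₀ ha, zpow_neg, zpow_natCast, Circle.coe_inv,
    inv_pow]
  ring

theorem setIntegral_gaussMonomial_eq_zero (m : ℝ) {j l k : ℕ} (h : l ≠ k + j) (ε : ℝ) :
    ∫ z in {w : ℂ | ε ≤ ‖w‖}, gaussMonomial m j l k z ∂dA = 0 := by
  have hN : ((l : ℤ) - j - k) ≠ 0 := by omega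
  set N : ℤ := (l : ℤ) - j - k with hNdef
  have hN' : (N : ℂ) ≠ 0 := by exact_mod_cast hN
  have hpow : ((Circle.exp (Real.pi / N) : Circle) : ℂ) ^ N = -1 := by
    rw [Circle.coe_exp, ← Complex.exp_int_mul, ← Complex.exp_pi_mul_I]
    congr 1
    push_cast
    field_simp
  have h1 := setIntegral_rotation (Circle.exp (Real.pi / N)) (gaussMonomial m j l k) ε
  simp only [gaussMonomial_rotation, ← hNdef, hpow, integral_const_mul] at h1
  linear_combination (-1 / 2 : ℂ) * h1

/-- The truncated integrals of `f` exist, and their principal value is `L`. Unlike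
`PVIntegralEq`, this is stable under sums. -/
def HasPVIntegral (f : ℂ → ℂ) (μ : Measure ℂ) (L : ℂ) : Prop :=
  (∀ ε > 0, IntegrableOn f {w : ℂ | ε ≤ ‖w‖} μ) ∧ PVIntegralEq f μ L

theorem HasPVIntegral.const_mul {f : ℂ → ℂ} {μ : Measure ℂ} {L : ℂ}
    (h : HasPVIntegral f μ L) (c : ℂ) : HasPVIntegral (fun z => c * f z) μ (c * L) := by
  refine ⟨fun ε hε => (h.1 ε hε).const_mul c, ?_⟩
  simp only [PVIntegralEq, integral_const_mul]
  exact h.2.const_mul c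

theorem HasPVIntegral.sum {ι : Type*} (s : Finset ι) {f : ι → ℂ → ℂ} {μ : Measure ℂ} {L : ι → ℂ}
    (h : ∀ i ∈ s, HasPVIntegral (f i) μ (L i)) :
    HasPVIntegral (fun z => ∑ i ∈ s, f i z) μ (∑ i ∈ s, L i) := by
  refine ⟨fun ε hε => integrable_finsetSum s fun i hi => (h i hi).1 ε hε, ?_⟩
  refine (tendsto_finsetSum s fun i hi => (h i hi).2).congr' ?_
  filter_upwards [self_mem_nhdsWithin] with ε hε
  exact (integral_finsetSum s fun i hi => (h i hi).1 ε hε).symm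

theorem measurableSet_le_norm (ε : ℝ) : MeasurableSet {w : ℂ | ε ≤ ‖w‖} :=
  measurableSet_le measurable_const measurable_norm

theorem integrableOn_gaussMonomial {m : ℝ} (hm : 0 < m) (j l k : ℕ) {ε : ℝ} (hε : 0 < ε) :
    IntegrableOn (gaussMonomial m j l k) {w : ℂ | ε ≤ ‖w‖} dA := by
  have hg : Integrable (fun z : ℂ => (ε ^ j)⁻¹ *
      (‖z‖ ^ (l + k) * Real.exp (-(m * ‖z‖ ^ 2)))) dA :=
    ((integrable_norm_pow_mul_exp hm (l + k)).smul_measure inv_ofReal_pi_ne_top).const_mul _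
  refine hg.integrableOn.mono' ?_ ?_
  · refine Measurable.aestronglyMeasurable ?_
    unfold gaussMonomial
    simp only [zpow_neg, zpow_natCast]
    have : Measurable (starRingEnd ℂ) := Complex.continuous_conj.measurable
    fun_prop
  · refine (ae_restrict_iff' (measurableSet_le_norm ε)).2 (ae_of_all _ fun z hz => ?_)
    have hz' : ε ≤ ‖z‖ := hz
    have h0 : 0 < ‖z‖ := hε.trans_le hz'
    simp only [gaussMonomial, norm_mul, zpow_neg, zpow_natCast, norm_inv, norm_pow,
      RCLike.norm_conj, Complex.norm_real, Real.norm_eq_abs, Real.abs_exp, pow_add]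
    rw [mul_assoc, mul_assoc, mul_assoc]
    gcongr

theorem gaussMonomial_diag (m : ℝ) (j k : ℕ) {z : ℂ} (hz : z ≠ 0) :
    gaussMonomial m j (k + j) k z = ((‖z‖ ^ (2 * k) * Real.exp (-(m * ‖z‖ ^ 2)) : ℝ) : ℂ) := by
  have h : ((‖z‖ : ℂ)) ^ 2 = z * (starRingEnd ℂ) z := (Complex.mul_conj' z).symm
  simp only [gaussMonomial, zpow_neg, zpow_natCast, pow_add]
  rw [Complex.ofReal_mul, Complex.ofReal_pow, pow_mul, h, mul_pow]
  field_simp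

theorem ae_ne_zero_dA : ∀ᵐ z ∂dA, z ≠ 0 :=
  dA_absolutelyContinuous.ae_le (Measure.ae_ne volume 0)

theorem hasPVIntegral_gaussMonomial {m : ℝ} (hm : 0 < m) (j l k : ℕ) :
    HasPVIntegral (gaussMonomial m j l k) dA
      (if l = k + j then (k.factorial : ℂ) / (m : ℂ) ^ (k + 1) else 0) := by
  refine ⟨fun ε hε => integrableOn_gaussMonomial hm j l k hε, ?_⟩
  split_ifs with h
  · subst h
    have hae : gaussMonomial m j (k + j) k =ᵐ[dA]
        fun z => ((‖z‖ ^ (2 * k) * Real.exp (-(m * ‖z‖ ^ 2)) : ℝ) : ℂ) := by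
      filter_upwards [ae_ne_zero_dA] with z hz using gaussMonomial_diag m j k hz
    have hint : Integrable (gaussMonomial m j (k + j) k) dA :=
      (((integrable_norm_pow_mul_exp hm (2 * k)).smul_measure
        inv_ofReal_pi_ne_top).ofReal).congr hae.symm
    have hval : ∫ z, gaussMonomial m j (k + j) k z ∂dA =
        (k.factorial : ℂ) / (m : ℂ) ^ (k + 1) := by
      rw [integral_congr_ae hae, integral_complex_ofReal, integral_norm_pow_mul_exp hm k]
      push_cast
      rfl
    have hcov : AECover dA (nhdsWithin 0 (Set.Ioi 0)) fun ε : ℝ => {w : ℂ | ε ≤ ‖w‖} := by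
      refine ⟨?_, measurableSet_le_norm⟩
      filter_upwards [ae_ne_zero_dA] with z hz
      exact nhdsWithin_le_nhds (eventually_le_nhds (norm_pos_iff.2 hz))
    rw [← hval]
    exact hcov.integral_tendsto_of_countably_generated hint
  · simp only [PVIntegralEq, setIntegral_gaussMonomial_eq_zero m h]
    exact tendsto_const_nhds

theorem ER_natCast_sub_one (n : ℕ) (x : ℝ) :
    ER ((n : ℤ) - 1) x = ∑ i ∈ Finset.range n, x ^ i / i.factorial := by
  simp [ER]

theorem ER_natCast_sub_one_pos {n : ℕ} (hn : 0 < n) {x : ℝ} (hx : 0 < x) :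
    0 < ER ((n : ℤ) - 1) x := by
  rw [ER_natCast_sub_one]
  exact Finset.sum_pos (fun i _ => by positivity) ⟨0, Finset.mem_range.2 hn⟩

theorem zpow_mul_berBF (m : ℝ) (n j : ℕ) (z₀ z : ℂ) :
    z ^ (-(j : ℤ)) * (berBF m n z₀ z : ℂ) =
      ∑ l ∈ Finset.range n, ∑ k ∈ Finset.range n,
        ((m : ℂ) / (ER ((n : ℤ) - 1) (m * ‖z₀‖ ^ 2) : ℂ) *
          (((m : ℂ) * (starRingEnd ℂ) z₀) ^ l / l.factorial *
            (((m : ℂ) * z₀) ^ k / k.factorial))) * gaussMonomial m j l k z := by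
  have hE : EC ((n : ℤ) - 1) ((m : ℂ) * z * (starRingEnd ℂ) z₀) =
      ∑ l ∈ Finset.range n, ((m : ℂ) * (starRingEnd ℂ) z₀) ^ l / l.factorial * z ^ l := by
    simp only [EC, sub_add_cancel, Int.toNat_natCast]
    exact Finset.sum_congr rfl fun l _ => by ring
  have hE' : (starRingEnd ℂ) (EC ((n : ℤ) - 1) ((m : ℂ) * z * (starRingEnd ℂ) z₀)) =
      ∑ k ∈ Finset.range n, ((m : ℂ) * z₀) ^ k / k.factorial * (starRingEnd ℂ) z ^ k := by
    simp [hE]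
  rw [berBF]
  push_cast
  rw [← Complex.mul_conj', hE', hE, Finset.sum_mul_sum]
  simp only [Finset.mul_sum, Finset.sum_mul, Finset.sum_div]
  refine Finset.sum_congr rfl fun l _ => Finset.sum_congr rfl fun k _ => ?_
  simp only [gaussMonomial]
  push_cast
  ring

theorem hasPVIntegral_zpow_mul_berBF {z₀ : ℂ} (hz₀ : z₀ ≠ 0) {m : ℝ} (hm : 0 < m) {n j : ℕ}
    (hj : j < n) :
    HasPVIntegral (fun z => z ^ (-(j : ℤ)) * (berBF m n z₀ z : ℂ)) dA
      ((z₀ ^ (-(j : ℤ))) *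
        (1 - (ER ((j : ℤ) - 1) (m * ‖z₀‖ ^ 2) / ER ((n : ℤ) - 1) (m * ‖z₀‖ ^ 2) : ℝ))) := by
  simp only [zpow_mul_berBF]
  have h := HasPVIntegral.sum (Finset.range n) fun l _ =>
    HasPVIntegral.sum (Finset.range n) fun k _ =>
      (hasPVIntegral_gaussMonomial hm j l k).const_mul
        ((m : ℂ) / (ER ((n : ℤ) - 1) (m * ‖z₀‖ ^ 2) : ℂ) *
          (((m : ℂ) * (starRingEnd ℂ) z₀) ^ l / l.factorial *
            (((m : ℂ) * z₀) ^ k / k.factorial)))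
  convert h using 1
  have hx : 0 < m * ‖z₀‖ ^ 2 := by have := norm_pos_iff.2 hz₀; positivity
  have hE := (ER_natCast_sub_one_pos (Nat.zero_lt_of_lt hj) hx).ne'
  have hEC : (ER ((n : ℤ) - 1) (m * ‖z₀‖ ^ 2) : ℂ) ≠ 0 := by exact_mod_cast hE
  have hmC : (m : ℂ) ≠ 0 := by exact_mod_cast hm.ne'
  obtain ⟨p, rfl⟩ := Nat.exists_eq_add_of_lt hj
  have hsplit : (ER (((j + p + 1 : ℕ) : ℤ) - 1) (m * ‖z₀‖ ^ 2) : ℂ) =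
      ER ((j : ℤ) - 1) (m * ‖z₀‖ ^ 2) + ∑ i ∈ Finset.range (p + 1),
        (m * (z₀ * (starRingEnd ℂ) z₀)) ^ (j + i) / ((j + i).factorial : ℂ) := by
    rw [ER_natCast_sub_one, ER_natCast_sub_one, add_assoc, Finset.sum_range_add, Complex.mul_conj']
    push_cast
    rfl
  have hlow : ∀ l ∈ Finset.range j, ∑ k ∈ Finset.range (j + (p + 1)),
      ((m : ℂ) / (ER (((j + p + 1 : ℕ) : ℤ) - 1) (m * ‖z₀‖ ^ 2) : ℂ) *
          (((m : ℂ) * (starRingEnd ℂ) z₀) ^ l / l.factorial *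
            (((m : ℂ) * z₀) ^ k / k.factorial))) *
        (if l = k + j then (k.factorial : ℂ) / (m : ℂ) ^ (k + 1) else 0) = 0 := by
    intro l hl
    refine Finset.sum_eq_zero fun k _ => ?_
    rw [if_neg (by have := Finset.mem_range.1 hl; omega), mul_zero]
  have hhigh : ∀ i ∈ Finset.range (p + 1), ∑ k ∈ Finset.range (j + (p + 1)),
      ((m : ℂ) / (ER (((j + p + 1 : ℕ) : ℤ) - 1) (m * ‖z₀‖ ^ 2) : ℂ) *
          (((m : ℂ) * (starRingEnd ℂ) z₀) ^ (j + i) / (j + i).factorial *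
            (((m : ℂ) * z₀) ^ k / k.factorial))) *
        (if j + i = k + j then (k.factorial : ℂ) / (m : ℂ) ^ (k + 1) else 0) =
      z₀ ^ (-(j : ℤ)) / (ER (((j + p + 1 : ℕ) : ℤ) - 1) (m * ‖z₀‖ ^ 2) : ℂ) *
        ((m * (z₀ * (starRingEnd ℂ) z₀)) ^ (j + i) / ((j + i).factorial : ℂ)) := by
    intro i hi
    have hf : ((i.factorial : ℕ) : ℂ) ≠ 0 := by exact_mod_cast i.factorial_ne_zero
    have hf' : (((j + i).factorial : ℕ) : ℂ) ≠ 0 := by exact_mod_cast (j + i).factorial_ne_zero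
    rw [Finset.sum_eq_single i]
    · rw [if_pos (add_comm j i), zpow_neg, zpow_natCast]
      simp only [mul_pow, pow_add, pow_one]
      field_simp
    · intro k _ hk
      rw [if_neg (by omega), mul_zero]
    · intro h
      have := Finset.mem_range.1 hi
      exact absurd (Finset.mem_range.2 (by omega)) h
  conv_rhs => rw [show Finset.range (j + p + 1) = Finset.range (j + (p + 1)) from rfl]
  rw [Finset.sum_range_add, Finset.sum_eq_zero hlow, zero_add, Finset.sum_congr rfl hhigh,
    ← Finset.mul_sum, ← sub_eq_of_eq_add' hsplit]
  push_cast
  push_cast at hEC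
  field_simp

theorem ER_div_ER_nonneg (j n : ℤ) {x : ℝ} (hx : 0 ≤ x) : 0 ≤ ER j x / ER n x :=
  div_nonneg (Finset.sum_nonneg fun i _ => by positivity)
    (Finset.sum_nonneg fun i _ => by positivity)

theorem ER_div_ER_le {d n j : ℕ} (hj : j ≤ d) (hn : d + 1 ≤ n) {x : ℝ} (hx : 1 ≤ x) :
    ER ((j : ℤ) - 1) x / ER ((n : ℤ) - 1) x ≤ d * d.factorial / x := by
  have hx0 : 0 < x := by linarith
  have hnum : x * ER ((j : ℤ) - 1) x ≤ d * x ^ d := by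
    rw [ER_natCast_sub_one, Finset.mul_sum]
    calc ∑ i ∈ Finset.range j, x * (x ^ i / i.factorial)
        ≤ ∑ i ∈ Finset.range j, x ^ d := by
          refine Finset.sum_le_sum fun i hi => ?_
          have hi' := Finset.mem_range.1 hi
          calc x * (x ^ i / i.factorial) ≤ x * x ^ i := by
                gcongr
                exact div_le_self (by positivity) (by exact_mod_cast i.factorial_pos)
            _ = x ^ (i + 1) := by ring
            _ ≤ x ^ d := pow_le_pow_right₀ hx (by omega)
      _ = j * x ^ d := by simp
      _ ≤ d * x ^ d := by gcongr
  have hden : x ^ d / d.factorial ≤ ER ((n : ℤ) - 1) x := by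
    rw [ER_natCast_sub_one]
    exact Finset.single_le_sum (f := fun i : ℕ => x ^ i / (i.factorial : ℝ))
      (fun i _ => by positivity) (Finset.mem_range.2 hn)
  have hf : (0 : ℝ) < d.factorial := by exact_mod_cast d.factorial_pos
  rw [div_le_div_iff₀ (ER_natCast_sub_one_pos (by omega) hx0) hx0]
  calc ER ((j : ℤ) - 1) x * x = x * ER ((j : ℤ) - 1) x := mul_comm _ _
    _ ≤ d * x ^ d := hnum
    _ = d * d.factorial * (x ^ d / d.factorial) := by field_simp
    _ ≤ _ := by gcongr

/-- for `Q(z)=|z|²`, `z₀ ≠ 0`, `0 ≤ j ≤ d < n`,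
`p.v.∫ z^{−j} dB^{z₀}_{m,n} = z₀^{−j}(1 − E_{j−1}(m|z₀|²)/E_{n−1}(m|z₀|²))`; consequently
`p.v.∫ u(z⁻¹) dB^{z₀}_{m,n} → u(z₀⁻¹)` as `m → ∞`, uniformly in `n ≥ d+1`, for every
polynomial `u` of degree at most `d`. -/
theorem bargmann_fock_pv_moments
    (z₀ : ℂ) (hz₀ : z₀ ≠ 0) (d : ℕ) (hd : 0 < d) :
    (∀ (m : ℝ), 0 < m → ∀ (n : ℕ), d + 1 ≤ n → ∀ j : ℕ, j ≤ d →
      PVIntegralEq (fun z => z ^ (-(j : ℤ)) * (berBF m n z₀ z : ℂ)) dA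
        ((z₀ ^ (-(j : ℤ))) *
          (1 - (ER ((j : ℤ) - 1) (m * ‖z₀‖ ^ 2) / ER ((n : ℤ) - 1) (m * ‖z₀‖ ^ 2) : ℝ)))) ∧
    (∀ u : Polynomial ℂ, u.natDegree ≤ d → ∀ δ > (0:ℝ), ∃ M : ℝ, ∀ m ≥ M, ∀ n : ℕ,
      d + 1 ≤ n → ∃ L : ℂ,
        PVIntegralEq (fun z => u.eval z⁻¹ * (berBF m n z₀ z : ℂ)) dA L ∧
        ‖L - u.eval z₀⁻¹‖ < δ) := by
  refine ⟨fun m hm n hn j hj => (hasPVIntegral_zpow_mul_berBF hz₀ hm (by omega)).2, ?_⟩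
  intro u hu δ hδ
  have hr : 0 < ‖z₀‖ ^ 2 := by have := norm_pos_iff.2 hz₀; positivity
  set C : ℝ := ∑ j ∈ Finset.range (d + 1), ‖u.coeff j * z₀ ^ (-(j : ℤ))‖ with hC
  have hlim : Tendsto (fun m : ℝ => C * (d * d.factorial / (m * ‖z₀‖ ^ 2))) atTop (nhds 0) := by
    have h := (tendsto_const_nhds (x := (d * d.factorial : ℝ))).div_atTop
      (tendsto_id.atTop_mul_const hr)
    simpa using h.const_mul C
  obtain ⟨M, hM⟩ := eventually_atTop.1 ((hlim.eventually_lt_const hδ).and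
    ((tendsto_id.atTop_mul_const hr).eventually_ge_atTop 1))
  refine ⟨M, fun m hm n hn => ?_⟩
  obtain ⟨hlt, hx⟩ := hM m hm
  simp only [id] at hx
  have hm0 : 0 < m := pos_of_mul_pos_left (by linarith) hr.le
  have heval : ∀ z : ℂ, u.eval z⁻¹ =
      ∑ j ∈ Finset.range (d + 1), u.coeff j * z ^ (-(j : ℤ)) := fun z => by
    rw [Polynomial.eval_eq_sum_range' (Nat.lt_succ_of_le hu)]
    simp
  have hpv := HasPVIntegral.sum (Finset.range (d + 1)) fun j hj =>
    (hasPVIntegral_zpow_mul_berBF hz₀ hm0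
      (show j < n by have := Finset.mem_range.1 hj; omega)).const_mul (u.coeff j)
  refine ⟨_, by simpa only [PVIntegralEq, heval, Finset.sum_mul, mul_assoc] using hpv.2, ?_⟩
  refine lt_of_le_of_lt ?_ hlt
  rw [heval, ← Finset.sum_sub_distrib, hC, Finset.sum_mul]
  refine norm_sum_le_of_le _ fun j hj => ?_
  have hj' := Finset.mem_range.1 hj
  rw [← mul_sub, ← mul_sub_one, ← mul_assoc, norm_mul, sub_sub_cancel_left, norm_neg,
    Complex.norm_real, Real.norm_eq_abs, abs_of_nonneg (ER_div_ER_nonneg _ _ (by linarith))]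
  exact mul_le_mul_of_nonneg_left (ER_div_ER_le (by omega) hn hx) (norm_nonneg _)
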